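/- Let G be a graph (possibly with parallel edges), let δ be a regular infinite cardinal, let p be a natural number, and let a, b be two vertices of G admitting a family 𝒫 of δ pairwise edge-disjoint a–b paths, each of length at most p. Then there exist a natural number k ≤ p and distinct vertices a = t₀, t₁, …, t_k = b, each lying on some path of 𝒫, such that κ_V(t_i, t_{i+1}) ≥ δ for every i with 0 ≤ i ≤ k−1, and moreover there exists a subfamily 𝒫′ ⊆ 𝒫 of size δ such that every path P ∈ 𝒫′ contains all of the vertices t₀, …, t_k and traverses them exactly in this order when going from a to b. -/

import Mathlib

universe u

/-- A multigraph: possibly parallel edges, no loops. Each edge `e` has a pair of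
distinct endpoints `ends e`. -/
structure Multigraph (V : Type u) (E : Type u) : Type u where
  ends : E → Sym2 V
  not_loop : ∀ e, ¬ (ends e).IsDiag

namespace Multigraph

variable {V E : Type u}

/-- A path from `a` to `b` in a multigraph, given by its (duplicate-free) list of
vertices, traversed from `a` to `b`, together with the list of edges it uses. -/
structure Path (G : Multigraph V E) (a b : V) : Type u where
  verts : List V
  edges : List E
  nodup : verts.Nodup
  length_eq : verts.length = edges.length + 1
  head_eq : verts.head? = some a
  last_eq : verts.getLast? = some b
  inc : ∀ i, ∀ h : i + 1 < verts.length,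
    G.ends (edges[i]'(by omega)) = s(verts[i]'(by omega), verts[i + 1]'h)

variable {G : Multigraph V E}

/-- The length of a path is its number of edges. -/
def Path.length {a b : V} (P : G.Path a b) : ℕ := P.edges.length

/-- Two paths are edge-disjoint if they share no edge. -/
def EdgeDisjoint {a b a' b' : V} (P : G.Path a b) (Q : G.Path a' b') : Prop :=
  ∀ e, e ∈ P.edges → e ∉ Q.edges

/-- Two (oriented) paths are order-compatible if their common vertices occur in the
same order along both. -/
def OrderCompatible {a b a' b' : V} (P : G.Path a b) (Q : G.Path a' b') : Prop :=
  ∀ u v : V, u ∈ P.verts → v ∈ P.verts → u ∈ Q.verts → v ∈ Q.verts →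
    ([u, v].Sublist P.verts ↔ [u, v].Sublist Q.verts)

/-- Two `a`–`b` paths are internally disjoint if they meet only in `a` and `b`. -/
def InternallyDisjoint {a b : V} (P Q : G.Path a b) : Prop :=
  ∀ x, x ∈ P.verts → x ∈ Q.verts → x = a ∨ x = b

/-- `κ_V(a,b) ≥ δ`: there are `δ` pairwise internally vertex-disjoint `a`–`b` paths. -/
def KappaVGe (G : Multigraph V E) (a b : V) (δ : Cardinal.{u}) : Prop :=
  ∃ S : Set (G.Path a b), S.Pairwise InternallyDisjoint ∧ δ ≤ Cardinal.mk S

end Multigraph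

namespace List

theorem exists_eq_append_of_append_cons_cons_sublist {α : Type*} {l₁ l₂ l : List α} {x y : α}
    (h : (l₁ ++ x :: y :: l₂).Sublist l) :
    ∃ A M B : List α, l = A ++ x :: (M ++ y :: B) ∧ l₁.Sublist A ∧ l₂.Sublist B := by
  obtain ⟨A, R, rfl, hA, hR⟩ := append_sublist_iff.1 h
  obtain ⟨r₁, r₂, rfl, hx, hr⟩ := cons_sublist_iff.1 hR
  obtain ⟨r₃, r₄, rfl, hy, hB⟩ := cons_sublist_iff.1 hr
  obtain ⟨C, D, rfl⟩ := append_of_mem hx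
  obtain ⟨E, F, rfl⟩ := append_of_mem hy
  exact ⟨A ++ C, D ++ E, F ++ r₄, by simp, hA.trans (sublist_append_left _ _),
    hB.trans (sublist_append_right _ _)⟩

theorem append_cons_cons_cons_sublist {α : Type*} {l₁ l₂ A M B : List α} {x y v : α}
    (hA : l₁.Sublist A) (hB : l₂.Sublist B) (hv : v ∈ M) :
    (l₁ ++ x :: v :: y :: l₂).Sublist (A ++ x :: (M ++ y :: B)) :=
  hA.append (((singleton_sublist.2 hv).append (hB.cons_cons y)).cons_cons x)

end List

namespace Multigraph

variable {V E : Type u} {G : Multigraph V E}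

theorem Path.edges_ne_nil {a b : V} (P : G.Path a b) (hab : a ≠ b) : P.edges ≠ [] := by
  intro h
  have h1 := P.length_eq
  rw [h, List.length_nil, zero_add, List.length_eq_one_iff] at h1
  obtain ⟨c, hc⟩ := h1
  have ha := P.head_eq
  have hb := P.last_eq
  simp only [hc, List.head?_cons, List.getLast?_singleton, Option.some.injEq] at ha hb
  exact hab (ha.symm.trans hb)

theorem Path.exists_segment {a b x y : V} (P : G.Path a b) {A M B : List V}
    (h : P.verts = A ++ x :: (M ++ y :: B)) :
    ∃ Q : G.Path x y, Q.verts = x :: (M ++ [y]) ∧ Q.edges ⊆ P.edges := by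
  have hl := P.length_eq
  have hlen : P.verts.length = A.length + M.length + B.length + 2 := by
    rw [h]; simp; omega
  have hsub : P.verts = A ++ ((x :: (M ++ [y])) ++ B) := by simp [h]
  refine ⟨⟨x :: (M ++ [y]), (P.edges.drop A.length).take (M.length + 1), ?_, ?_, rfl, ?_, ?_⟩,
    rfl, ?_⟩
  · have hn := P.nodup
    rw [hsub] at hn
    exact hn.of_append_right.of_append_left
  · simp; omega
  · rw [← List.cons_append, List.getLast?_concat]
  · intro i hi
    have key : ∀ j, ∀ hj : j < (x :: (M ++ [y])).length,
        (x :: (M ++ [y]))[j] = P.verts[A.length + j]'(by simp at hj; omega) := by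
      intro j hj
      have : P.verts[A.length + j]? = (x :: (M ++ [y]))[j]? := by
        rw [hsub, List.getElem?_append_right (by omega), Nat.add_sub_cancel_left,
          List.getElem?_append_left hj]
      rw [List.getElem?_eq_getElem hj, List.getElem?_eq_getElem (by simp at hj; omega)] at this
      exact (Option.some.inj this).symm
    rw [key i (by omega), key (i + 1) hi, List.getElem_take, List.getElem_drop]
    exact P.inc (A.length + i) (by simp at hi; omega)
  · exact fun e he => List.mem_of_mem_drop (List.mem_of_mem_take he)

theorem InternallyDisjoint.symm {a b : V} {P Q : G.Path a b} (h : InternallyDisjoint P Q) :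
    InternallyDisjoint Q P :=
  fun x hQ hP => h x hP hQ

theorem kappaVGe_of_edgeDisjoint {x y : V} (hxy : x ≠ y) {δ : Cardinal.{u}} (hδ : δ.IsRegular)
    {J : Type u} (hJ : Cardinal.mk J = δ) (Q : J → G.Path x y)
    (hQ : Pairwise fun i j => EdgeDisjoint (Q i) (Q j))
    (hv : ∀ v, v ≠ x → v ≠ y → Cardinal.mk {j | v ∈ (Q j).verts} < δ) :
    G.KappaVGe x y δ := by
  have hinj : Function.Injective Q := by
    intro i j hij
    by_contra hne
    obtain ⟨e, he⟩ := List.exists_mem_of_ne_nil _ ((Q i).edges_ne_nil hxy)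
    exact hQ hne e he (hij ▸ he)
  obtain ⟨T, hT⟩ := zorn_subset
    {T : Set J | T.Pairwise fun i j => InternallyDisjoint (Q i) (Q j)} (by
      intro c hc hchain
      exact ⟨⋃₀ c, (Set.pairwise_sUnion hchain.directedOn).2 fun s hs => hc hs,
        fun s hs => Set.subset_sUnion_of_mem hs⟩)
  refine ⟨Q '' T, ?_, ?_⟩
  · rintro _ ⟨i, hi, rfl⟩ _ ⟨j, hj, rfl⟩ hne
    exact hT.prop hi hj fun h => hne (congrArg Q h)
  rw [Cardinal.mk_image_eq hinj]
  by_contra! hlt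
  let W : Set V := ⋃ j ∈ T, {v | v ∈ (Q j).verts ∧ v ≠ x ∧ v ≠ y}
  have hW : Cardinal.mk W < δ := by
    refine (Cardinal.card_biUnion_lt_iff_forall_of_isRegular hδ hlt).2 fun j _ => ?_
    exact lt_of_lt_of_le (Cardinal.lt_aleph0_iff_set_finite.2
      ((List.finite_toSet (Q j).verts).subset fun v hv => hv.1)) hδ.aleph0_le
  let N : Set J := ⋃ v ∈ W, {j | v ∈ (Q j).verts}
  have hN : Cardinal.mk N < δ := by
    refine (Cardinal.card_biUnion_lt_iff_forall_of_isRegular hδ hW).2 fun v hvW => ?_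
    simp only [W, Set.mem_iUnion] at hvW
    obtain ⟨j, -, -, h1, h2⟩ := hvW
    exact hv v h1 h2
  have hcover : T ∪ N = Set.univ := by
    refine Set.eq_univ_of_forall fun j => ?_
    by_cases hjN : j ∈ N
    · exact Or.inr hjN
    refine Or.inl (hT.le_of_ge (y := insert j T) ?_ (Set.subset_insert j T)
      (Set.mem_insert j T))
    have hdis : ∀ i ∈ T, InternallyDisjoint (Q i) (Q j) := by
      intro i hi v hvi hvj
      by_contra! hne
      exact hjN (Set.mem_biUnion (Set.mem_biUnion hi ⟨hvi, hne⟩) hvj)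
    exact hT.prop.insert fun i hi _ => ⟨(hdis i hi).symm, hdis i hi⟩
  have hle := Cardinal.mk_union_le T N
  rw [hcover, Cardinal.mk_univ, hJ] at hle
  exact absurd hle (not_le.2 (Cardinal.add_lt_of_lt hδ.aleph0_le hlt hN))

/-- `L` is a list from `a` to `b` which is a subsequence of as many of the paths `P i` as there
are indices. -/
def IsSpine {ι : Type u} {a b : V} (P : ι → G.Path a b) (L : List V) : Prop :=
  L.head? = some a ∧ L.getLast? = some b ∧
    Cardinal.mk {i | L.Sublist (P i).verts} = Cardinal.mk ι

theorem Path.pair_sublist {a b : V} (P : G.Path a b) (hab : a ≠ b) :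
    [a, b].Sublist P.verts := by
  obtain ⟨l, hl⟩ := List.head?_eq_some_iff.1 P.head_eq
  have hb := List.mem_of_getLast? P.last_eq
  rw [hl] at hb ⊢
  exact (List.singleton_sublist.2 ((List.mem_cons.1 hb).resolve_left hab.symm)).cons_cons a

theorem exists_isSpine {ι : Type u} {a b : V} (P : ι → G.Path a b) :
    ∃ L, IsSpine P L := by
  by_cases hab : a = b
  · subst hab
    refine ⟨[a], rfl, rfl, ?_⟩
    have : {i | [a].Sublist (P i).verts} = Set.univ :=
      Set.eq_univ_of_forall fun i => List.singleton_sublist.2 (List.mem_of_head? (P i).head_eq)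
    rw [this, Cardinal.mk_univ]
  · refine ⟨[a, b], rfl, rfl, ?_⟩
    have : {i | [a, b].Sublist (P i).verts} = Set.univ :=
      Set.eq_univ_of_forall fun i => (P i).pair_sublist hab
    rw [this, Cardinal.mk_univ]

theorem IsSpine.nonempty {ι : Type u} [Nonempty ι] {a b : V} {P : ι → G.Path a b} {L : List V}
    (h : IsSpine P L) : ∃ i, L.Sublist (P i).verts := by
  have : Cardinal.mk {i | L.Sublist (P i).verts} ≠ 0 := h.2.2 ▸ Cardinal.mk_ne_zero ι
  obtain ⟨i, hi⟩ := Cardinal.mk_ne_zero_iff.1 this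
  exact ⟨i, hi⟩

theorem IsSpine.length_le {ι : Type u} [Nonempty ι] {a b : V} {P : ι → G.Path a b} {p : ℕ}
    (hlen : ∀ i, (P i).length ≤ p) {L : List V} (h : IsSpine P L) : L.length ≤ p + 1 := by
  obtain ⟨i, hi⟩ := h.nonempty
  have h1 := hi.length_le
  have h2 := (P i).length_eq
  have h3 : (P i).edges.length ≤ p := hlen i
  omega

theorem exists_isSpine_maximal {ι : Type u} [Nonempty ι] {a b : V} {P : ι → G.Path a b} {p : ℕ}
    (hlen : ∀ i, (P i).length ≤ p) :
    ∃ L, IsSpine P L ∧ ∀ L', IsSpine P L' → L'.length ≤ L.length := by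
  have hbdd : BddAbove (List.length '' {L | IsSpine P L}) := by
    refine ⟨p + 1, ?_⟩
    rintro _ ⟨L, hL, rfl⟩
    exact IsSpine.length_le hlen hL
  obtain ⟨L, hL, hmax⟩ := Nat.sSup_mem (Set.Nonempty.image _ (exists_isSpine P)) hbdd
  exact ⟨L, hL, fun L' hL' => hmax ▸ le_csSup hbdd ⟨L', hL', rfl⟩⟩

/-- Consecutive vertices of a spine of maximal length cannot be separated by few vertices: a
vertex on many of the segments between them could be inserted into the spine. -/
theorem IsSpine.kappaVGe {ι : Type u} {a b x y : V} {P : ι → G.Path a b} {L₁ L₂ : List V}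
    (hreg : (Cardinal.mk ι).IsRegular)
    (hdisj : Pairwise fun i j => EdgeDisjoint (P i) (P j)) (hxy : x ≠ y)
    (hL : IsSpine P (L₁ ++ x :: y :: L₂))
    (hmax : ∀ L', IsSpine P L' → L'.length ≤ (L₁ ++ x :: y :: L₂).length) :
    G.KappaVGe x y (Cardinal.mk ι) := by
  have hseg : ∀ i : {i | (L₁ ++ x :: y :: L₂).Sublist (P i).verts}, ∃ Q : G.Path x y,
      Q.edges ⊆ (P i).edges ∧ ∀ v ∈ Q.verts, v ≠ x → v ≠ y →
        (L₁ ++ x :: v :: y :: L₂).Sublist (P i).verts := by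
    rintro ⟨i, hi⟩
    obtain ⟨A, M, B, h, hA, hB⟩ := List.exists_eq_append_of_append_cons_cons_sublist hi
    obtain ⟨Q, hQv, hQe⟩ := (P i).exists_segment h
    refine ⟨Q, hQe, fun v hv hvx hvy => ?_⟩
    rw [hQv] at hv
    rw [h]
    refine List.append_cons_cons_cons_sublist hA hB ?_
    simpa [hvx, hvy] using hv
  choose Q hQe hQv using hseg
  refine kappaVGe_of_edgeDisjoint hxy hreg hL.2.2 Q ?_ ?_
  · exact fun i j hij e hi hj => hdisj (Subtype.coe_injective.ne hij) e (hQe i hi) (hQe j hj)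
  · intro v hvx hvy
    have hle : Cardinal.mk {j | v ∈ (Q j).verts} ≤
        Cardinal.mk {i | (L₁ ++ x :: v :: y :: L₂).Sublist (P i).verts} :=
      Cardinal.mk_le_of_injective
        (f := fun j => ⟨j.1.1, hQv j.1 v j.2 hvx hvy⟩)
        fun i j hij => Subtype.ext (Subtype.ext (by simpa using hij))
    refine hle.trans_lt (lt_of_le_of_ne (Cardinal.mk_set_le _) fun heq => ?_)
    have := hmax (L₁ ++ x :: v :: y :: L₂) ⟨?_, ?_, heq⟩
    · simp at this
    · have := hL.1
      cases L₁ <;> simpa using this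
    · have := hL.2.1
      simpa using this

end Multigraph

/-- **Lemma 2.1** (the regular case).  Given `δ` (regular infinite) pairwise edge-disjoint
`a`–`b` paths of length at most `p`, there is a sequence `a = t₀, …, t_k = b` (`k ≤ p`) of
distinct vertices lying on the paths with `κ_V(tᵢ, tᵢ₊₁) ≥ δ`, and a subfamily of size `δ`
all of whose members traverse all of `t₀, …, t_k` exactly in this order. -/
theorem regular_spine {V E : Type u} (G : Multigraph V E)
    (δ : Cardinal.{u}) (hreg : δ.IsRegular) (p : ℕ) (a b : V)
    (ι : Type u) (P : ι → G.Path a b) (hcard : Cardinal.mk ι = δ)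
    (hdisj : Pairwise fun i j => Multigraph.EdgeDisjoint (P i) (P j))
    (hlen : ∀ i, (P i).length ≤ p) :
    ∃ (k : ℕ) (t : Fin (k + 1) → V), k ≤ p ∧ Function.Injective t ∧
      t 0 = a ∧ t (Fin.last k) = b ∧
      (∀ m : Fin (k + 1), ∃ i, t m ∈ (P i).verts) ∧
      (∀ m : Fin k, G.KappaVGe (t m.castSucc) (t m.succ) δ) ∧
      ∃ s : Set ι, Cardinal.mk s = δ ∧
        ∀ i ∈ s, (List.ofFn t).Sublist (P i).verts := by
  subst hcard
  have : Nonempty ι := Cardinal.mk_ne_zero_iff.1 hreg.ne_zero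
  obtain ⟨L, hL, hmax⟩ := Multigraph.exists_isSpine_maximal hlen
  obtain ⟨i₀, hi₀⟩ := hL.nonempty
  have hnodup : L.Nodup := hi₀.nodup (P i₀).nodup
  have hle := Multigraph.IsSpine.length_le hlen hL
  obtain ⟨k, hk⟩ : ∃ k, L.length = k + 1 := by
    refine Nat.exists_eq_succ_of_ne_zero fun h => ?_
    have := hL.1
    simp [List.length_eq_zero_iff.1 h] at this
  have hofFn : List.ofFn (fun m : Fin (k + 1) => L[(m : ℕ)]'(by omega)) = L :=
    List.ext_getElem (by simp [hk]) fun _ _ _ => by rw [List.getElem_ofFn]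
  refine ⟨k, fun m => L[(m : ℕ)]'(by omega), by omega, ?_, ?_, ?_, ?_, ?_,
    {i | L.Sublist (P i).verts}, hL.2.2, ?_⟩
  · exact fun m n h => Fin.ext ((hnodup.getElem_inj_iff).1 h)
  · have := hL.1
    rw [List.head?_eq_getElem?, List.getElem?_eq_getElem (by omega)] at this
    exact Option.some.inj this
  · have := hL.2.1
    rw [List.getLast?_eq_getElem?, List.getElem?_eq_getElem (by omega)] at this
    simpa [hk] using this
  · exact fun m => ⟨i₀, hi₀.subset (List.getElem_mem _)⟩
  · intro m
    have hm : (m : ℕ) + 1 < L.length := by omega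
    have hsplit : L = L.take m ++ L[(m : ℕ)] :: L[(m : ℕ) + 1] :: L.drop (m + 2) := by
      rw [← List.drop_eq_getElem_cons hm, ← List.drop_eq_getElem_cons, List.take_append_drop]
    have hne : L[(m : ℕ)] ≠ L[(m : ℕ) + 1] := fun h => by
      have := (hnodup.getElem_inj_iff).1 h
      omega
    exact Multigraph.IsSpine.kappaVGe hreg hdisj hne (hsplit ▸ hL) (hsplit ▸ hmax)
  · intro i hi
    rw [hofFn]
    exact hi
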